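/- Double lacunary series norm equivalence: let f ∈ Λ_p, 1<p<∞, with Fourier series Σ_{μ₁=0}^∞ Σ_{μ₂=0}^∞ λ_{μ₁,μ₂} cos 2^{μ₁}x cos 2^{μ₂}y. Then ‖f‖_{L_p(T²)} ≍ (Σ_{μ₁=0}^∞ Σ_{μ₂=0}^∞ λ_{μ₁,μ₂}²)^{1/2}, with constants independent of f. -/

import Mathlib

open MeasureTheory Real
open scoped ENNReal

noncomputable section

/-- The `L_p` norm of a function of two variables over the period square `(0,2π]²`. -/
def Lp2Norm (p : ℝ) (f : ℝ → ℝ → ℝ) : ℝ≥0∞ :=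
  (∫⁻ x in Set.Ioc (0:ℝ) (2*π), ∫⁻ y in Set.Ioc (0:ℝ) (2*π),
      ENNReal.ofReal (|f x y| ^ p)) ^ (1/p)

/-- `f ∈ L_p^0(T²)`: measurable, `2π`-periodic in each variable, finite `L_p` norm,
and zero mean in each variable separately. -/
structure MemLp0 (p : ℝ) (f : ℝ → ℝ → ℝ) : Prop where
  meas : Measurable (Function.uncurry f)
  periodic_x : ∀ y, Function.Periodic (fun x => f x y) (2*π)
  periodic_y : ∀ x, Function.Periodic (f x) (2*π)
  norm_ne_top : Lp2Norm p f ≠ ⊤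
  mean_x : ∀ᵐ (y : ℝ) ∂volume, (∫ x in (0:ℝ)..(2*π), f x y) = 0
  mean_y : ∀ᵐ (x : ℝ) ∂volume, (∫ y in (0:ℝ)..(2*π), f x y) = 0

/-- Generalized (fractional) binomial coefficient `C(α,ν) = α(α-1)⋯(α-ν+1)/ν!`. -/
def fracBinom (α : ℝ) : ℕ → ℝ
  | 0 => 1
  | n+1 => fracBinom α n * (α - (n : ℝ)) / ((n : ℝ) + 1)

/-- Fractional difference of order `α` with step `h` in the first variable. -/
def diffX (α h : ℝ) (f : ℝ → ℝ → ℝ) : ℝ → ℝ → ℝ :=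
  fun x y => ∑' ν : ℕ, (-1 : ℝ) ^ ν * fracBinom α ν * f (x + (α - (ν : ℝ)) * h) y

/-- Fractional difference of order `α` with step `h` in the second variable. -/
def diffY (α h : ℝ) (f : ℝ → ℝ → ℝ) : ℝ → ℝ → ℝ :=
  fun x y => ∑' ν : ℕ, (-1 : ℝ) ^ ν * fracBinom α ν * f x (y + (α - (ν : ℝ)) * h)

/-- The mixed (fractional) modulus of smoothness `ω_{α₁,α₂}(f, δ₁, δ₂)_p`. -/
def mixedMod (p α₁ α₂ δ₁ δ₂ : ℝ) (f : ℝ → ℝ → ℝ) : ℝ≥0∞ :=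
  ⨆ (h₁ : ℝ) (_ : |h₁| ≤ δ₁) (h₂ : ℝ) (_ : |h₂| ≤ δ₂),
    Lp2Norm p (diffX α₁ h₁ (diffY α₂ h₂ f))

/-- Cosine-cosine Fourier coefficient `a_{n₁,n₂}` of `f`. -/
def fourierCC (f : ℝ → ℝ → ℝ) (n₁ n₂ : ℕ) : ℝ :=
  (1/π^2) * ∫ x in (0:ℝ)..(2*π), ∫ y in (0:ℝ)..(2*π),
    f x y * Real.cos ((n₁ : ℝ) * x) * Real.cos ((n₂ : ℝ) * y)

/-- Sine-cosine Fourier coefficient `b_{n₁,n₂}` of `f`. -/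
def fourierSC (f : ℝ → ℝ → ℝ) (n₁ n₂ : ℕ) : ℝ :=
  (1/π^2) * ∫ x in (0:ℝ)..(2*π), ∫ y in (0:ℝ)..(2*π),
    f x y * Real.sin ((n₁ : ℝ) * x) * Real.cos ((n₂ : ℝ) * y)

/-- Cosine-sine Fourier coefficient `c_{n₁,n₂}` of `f`. -/
def fourierCS (f : ℝ → ℝ → ℝ) (n₁ n₂ : ℕ) : ℝ :=
  (1/π^2) * ∫ x in (0:ℝ)..(2*π), ∫ y in (0:ℝ)..(2*π),
    f x y * Real.cos ((n₁ : ℝ) * x) * Real.sin ((n₂ : ℝ) * y)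

/-- Sine-sine Fourier coefficient `d_{n₁,n₂}` of `f`. -/
def fourierSS (f : ℝ → ℝ → ℝ) (n₁ n₂ : ℕ) : ℝ :=
  (1/π^2) * ∫ x in (0:ℝ)..(2*π), ∫ y in (0:ℝ)..(2*π),
    f x y * Real.sin ((n₁ : ℝ) * x) * Real.sin ((n₂ : ℝ) * y)

/-- The class `Λ_p`: `f ∈ L_p^0(T²)` with lacunary Fourier series
`Σ λ_{μ₁,μ₂} cos 2^{μ₁}x cos 2^{μ₂}y`. -/
def InLambdaClass (p : ℝ) (f : ℝ → ℝ → ℝ) (lam : ℕ → ℕ → ℝ) : Prop :=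
  MemLp0 p f ∧
  (∀ μ₁ μ₂ : ℕ, fourierCC f (2^μ₁) (2^μ₂) = lam μ₁ μ₂) ∧
  (∀ n₁ n₂ : ℕ, (¬ ∃ μ₁ μ₂ : ℕ, n₁ = 2^μ₁ ∧ n₂ = 2^μ₂) → fourierCC f n₁ n₂ = 0) ∧
  (∀ n₁ n₂ : ℕ, fourierSC f n₁ n₂ = 0 ∧ fourierCS f n₁ n₂ = 0 ∧ fourierSS f n₁ n₂ = 0)

theorem integral_exp_sum_cos_two_pow_le (n : ℕ) (a : ℕ → ℝ) :
    ∫ x in (0:ℝ)..(2 * π), exp (∑ j ∈ Finset.range n, a j * cos (2 ^ j * x)) ≤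
      2 * π * exp (∑ j ∈ Finset.range n, a j ^ 2 / 2) := by
  induction n generalizing a with
  | zero => simp
  | succ n ih =>
    set H : ℝ → ℝ := fun x => exp (∑ j ∈ Finset.range n, a (j + 1) * cos (2 ^ j * x)) with hH
    have hHc : Continuous H := by fun_prop
    have hper : ∀ x, H (x + 2 * π) = H x := by
      intro x
      simp only [hH]
      congr 1
      refine Finset.sum_congr rfl fun j _ => ?_
      have h := Real.cos_add_nat_mul_two_pi (2 ^ j * x) (2 ^ j)
      push_cast at h
      rw [mul_add, h]
    have hsplit : ∀ x, exp (∑ j ∈ Finset.range (n + 1), a j * cos (2 ^ j * x)) =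
        exp (a 0 * cos x) * H (2 * x) := by
      intro x
      rw [Finset.sum_range_succ', exp_add, mul_comm]
      simp only [hH, pow_zero, one_mul, pow_succ, mul_assoc]
    simp_rw [hsplit]
    have hc : Continuous fun x => exp (a 0 * cos x) * H (2 * x) := by fun_prop
    have hc' : Continuous fun x => exp (-(a 0 * cos x)) * H (2 * x) := by fun_prop
    have hshift : ∫ x in π..(2 * π), exp (a 0 * cos x) * H (2 * x) =
        ∫ x in (0:ℝ)..π, exp (-(a 0 * cos x)) * H (2 * x) := by
      have h := intervalIntegral.integral_comp_add_right (a := 0) (b := π)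
        (fun x => exp (a 0 * cos x) * H (2 * x)) π
      rw [zero_add, ← two_mul] at h
      rw [← h]
      congr 1
      ext x
      rw [cos_add_pi, mul_neg, mul_add, hper]
    rw [← intervalIntegral.integral_add_adjacent_intervals (b := π)
      (hc.intervalIntegrable _ _) (hc.intervalIntegrable _ _), hshift,
      ← intervalIntegral.integral_add (hc.intervalIntegrable _ _) (hc'.intervalIntegrable _ _)]
    have hle : ∫ x in (0:ℝ)..π, (exp (a 0 * cos x) * H (2 * x) +
        exp (-(a 0 * cos x)) * H (2 * x)) ≤
        ∫ x in (0:ℝ)..π, 2 * exp (a 0 ^ 2 / 2) * H (2 * x) := by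
      refine intervalIntegral.integral_mono_on pi_pos.le ((hc.add hc').intervalIntegrable _ _)
        (Continuous.intervalIntegrable (by fun_prop) _ _) fun x _ => ?_
      have h1 : exp (a 0 * cos x) + exp (-(a 0 * cos x)) ≤ 2 * exp (a 0 ^ 2 / 2) := by
        have h2 := Real.cosh_le_exp_half_sq (a 0 * cos x)
        rw [Real.cosh_eq] at h2
        have h3 : exp ((a 0 * cos x) ^ 2 / 2) ≤ exp (a 0 ^ 2 / 2) := by
          apply exp_le_exp.2
          rw [mul_pow]
          nlinarith [Real.cos_sq_le_one x, sq_nonneg (a 0)]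
        linarith
      rw [← add_mul]
      exact mul_le_mul_of_nonneg_right h1 (exp_pos _).le
    refine hle.trans ?_
    rw [intervalIntegral.integral_const_mul, intervalIntegral.integral_comp_mul_left H two_ne_zero,
      mul_zero, Finset.sum_range_succ', exp_add]
    have := mul_le_mul_of_nonneg_left (ih fun j => a (j + 1)) (exp_pos (a 0 ^ 2 / 2)).le
    simp only [smul_eq_mul, hH]
    linarith

theorem exists_lintegral_sum_cos_two_pow_rpow_le {q : ℝ} (hq : 0 < q) :
    ∃ K : ℝ≥0∞, K ≠ ⊤ ∧ ∀ (n : ℕ) (a : ℕ → ℝ),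
      ∫⁻ x in Set.Ioc (0:ℝ) (2 * π), ‖∑ j ∈ Finset.range n, a j * cos (2 ^ j * x)‖ₑ ^ q ≤
        K * ENNReal.ofReal (∑ j ∈ Finset.range n, a j ^ 2) ^ (q / 2) := by
  refine ⟨ENNReal.ofReal (q ^ q * (2 * (2 * π * exp (1 / 2)))), ENNReal.ofReal_ne_top,
    fun n a => ?_⟩
  set A := ∑ j ∈ Finset.range n, a j ^ 2 with hA
  have hA0 : 0 ≤ A := Finset.sum_nonneg fun j _ => sq_nonneg _
  rcases hA0.eq_or_lt with h0 | hpos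
  · have hz : ∀ j ∈ Finset.range n, a j = 0 := fun j hj =>
      pow_eq_zero_iff two_ne_zero |>.1
        ((Finset.sum_eq_zero_iff_of_nonneg fun j _ => sq_nonneg (a j)).1 h0.symm j hj)
    have : ∀ x, ∑ j ∈ Finset.range n, a j * cos (2 ^ j * x) = 0 := fun x =>
      Finset.sum_eq_zero fun j hj => by rw [hz j hj, zero_mul]
    simp [this, ENNReal.zero_rpow_of_pos hq]
  set b : ℕ → ℝ := fun j => a j / √A with hb
  have hs : 0 < √A := sqrt_pos.2 hpos
  have hab : ∀ x, ∑ j ∈ Finset.range n, a j * cos (2 ^ j * x) =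
      √A * ∑ j ∈ Finset.range n, b j * cos (2 ^ j * x) := by
    intro x
    rw [Finset.mul_sum]
    refine Finset.sum_congr rfl fun j _ => ?_
    simp only [hb]
    field_simp
  have hb2 : ∑ j ∈ Finset.range n, b j ^ 2 / 2 = 1 / 2 := by
    simp only [hb, div_pow, sq_sqrt hA0]
    rw [← Finset.sum_div, ← Finset.sum_div, ← hA, div_self hpos.ne']
  set S : ℝ → ℝ := fun x => ∑ j ∈ Finset.range n, b j * cos (2 ^ j * x) with hS
  have hSc : Continuous S := by fun_prop
  have hE : Continuous fun x => exp (S x) := by fun_prop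
  have hE' : Continuous fun x => exp (-S x) := by fun_prop
  have hpt : ∀ x, ‖S x‖ₑ ^ q ≤ ENNReal.ofReal (q ^ q * (exp (S x) + exp (-S x))) := by
    intro x
    rw [Real.enorm_eq_ofReal_abs, ENNReal.ofReal_rpow_of_nonneg (abs_nonneg _) hq.le]
    apply ENNReal.ofReal_le_ofReal
    have h := ProbabilityTheory.rpow_abs_le_mul_max_exp (S x) hq.le (one_ne_zero (α := ℝ))
    simp only [abs_one, div_one, one_mul, neg_mul] at h
    refine h.trans (mul_le_mul_of_nonneg_left ?_ (by positivity))
    exact max_le (by linarith [exp_pos (-S x)]) (by linarith [exp_pos (S x)])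
  have hint : ∫ x in (0:ℝ)..(2 * π), q ^ q * (exp (S x) + exp (-S x)) ≤
      q ^ q * (2 * (2 * π * exp (1 / 2))) := by
    rw [intervalIntegral.integral_const_mul, intervalIntegral.integral_add
      (hE.intervalIntegrable _ _) (hE'.intervalIntegrable _ _)]
    refine mul_le_mul_of_nonneg_left ?_ (by positivity)
    have h1 := integral_exp_sum_cos_two_pow_le n b
    have h2 := integral_exp_sum_cos_two_pow_le n fun j => -b j
    simp only [neg_mul, Finset.sum_neg_distrib, neg_sq, hb2] at h1 h2
    linarith
  simp_rw [hab]
  calc ∫⁻ x in Set.Ioc (0:ℝ) (2 * π), ‖√A * S x‖ₑ ^ q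
      = ∫⁻ x in Set.Ioc (0:ℝ) (2 * π), ENNReal.ofReal A ^ (q / 2) * ‖S x‖ₑ ^ q := by
        refine lintegral_congr fun x => ?_
        rw [enorm_mul, ENNReal.mul_rpow_of_nonneg _ _ hq.le]
        congr 1
        rw [Real.enorm_eq_ofReal hs.le, Real.sqrt_eq_rpow, ← ENNReal.ofReal_rpow_of_pos hpos,
          ← ENNReal.rpow_mul]
        congr 1
        ring
    _ ≤ ∫⁻ x in Set.Ioc (0:ℝ) (2 * π), ENNReal.ofReal A ^ (q / 2) *
          ENNReal.ofReal (q ^ q * (exp (S x) + exp (-S x))) :=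
        lintegral_mono fun x => mul_le_mul_right (hpt x) _
    _ = ENNReal.ofReal A ^ (q / 2) *
          ENNReal.ofReal (∫ x in (0:ℝ)..(2 * π), q ^ q * (exp (S x) + exp (-S x))) := by
        rw [lintegral_const_mul _ (by fun_prop), intervalIntegral.integral_of_le (by positivity),
          ofReal_integral_eq_lintegral_ofReal]
        · exact (intervalIntegrable_iff_integrableOn_Ioc_of_le (by positivity)).1
            (Continuous.intervalIntegrable (by fun_prop) _ _)
        · exact Filter.Eventually.of_forall fun x => by positivity
    _ ≤ _ := by
        rw [mul_comm]
        exact mul_le_mul_left (ENNReal.ofReal_le_ofReal hint) _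

/-- Lebesgue measure on the period interval `(0, 2π]`. -/
abbrev periodMeasure : Measure ℝ := volume.restrict (Set.Ioc (0:ℝ) (2 * π))

/-- Lebesgue measure on the period square `(0, 2π]²`. -/
abbrev squareMeasure : Measure (ℝ × ℝ) := periodMeasure.prod periodMeasure

/-- The square partial sum `∑_{i,j < N} c i j cos (2^i x) cos (2^j y)`. -/
def lacunaryPoly (c : ℕ → ℕ → ℝ) (N : ℕ) (z : ℝ × ℝ) : ℝ :=
  ∑ j ∈ Finset.range N, (∑ i ∈ Finset.range N, c i j * cos (2 ^ i * z.1)) * cos (2 ^ j * z.2)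

/-- The sum of the squares of the coefficients in an `N × N` square. -/
def sqSum (c : ℕ → ℕ → ℝ) (N : ℕ) : ℝ :=
  ∑ j ∈ Finset.range N, ∑ i ∈ Finset.range N, c i j ^ 2

theorem continuous_lacunaryPoly (c : ℕ → ℕ → ℝ) (N : ℕ) : Continuous (lacunaryPoly c N) := by
  unfold lacunaryPoly
  fun_prop

theorem sqSum_nonneg (c : ℕ → ℕ → ℝ) (N : ℕ) : 0 ≤ sqSum c N :=
  Finset.sum_nonneg fun _ _ => Finset.sum_nonneg fun _ _ => sq_nonneg _

theorem lintegral_sum_sq_rpow_le {α : Type*} [MeasurableSpace α] {μ : Measure α} {q : ℝ}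
    (hq : 2 ≤ q) (s : Finset ℕ) (a : ℕ → α → ℝ) (ha : ∀ j, Measurable (a j)) (B : ℕ → ℝ≥0∞)
    (hB : ∀ j ∈ s, ∫⁻ x, ‖a j x‖ₑ ^ q ∂μ ≤ B j ^ (q / 2)) :
    ∫⁻ x, ENNReal.ofReal (∑ j ∈ s, a j x ^ 2) ^ (q / 2) ∂μ ≤ (∑ j ∈ s, B j) ^ (q / 2) := by
  have hq2 : 0 < q / 2 := by linarith
  have hne : ENNReal.ofReal (q / 2) ≠ 0 := by simpa using hq2
  have htr : (ENNReal.ofReal (q / 2)).toReal = q / 2 := ENNReal.toReal_ofReal hq2.le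
  have hone : 1 ≤ ENNReal.ofReal (q / 2) := by
    rw [ENNReal.one_le_ofReal]; linarith
  have hterm : ∀ j ∈ s, eLpNorm (fun x => a j x ^ 2) (ENNReal.ofReal (q / 2)) μ ≤ B j := by
    intro j hj
    rw [eLpNorm_eq_lintegral_rpow_enorm_toReal hne ENNReal.ofReal_ne_top, htr, one_div,
      ENNReal.rpow_inv_le_iff hq2]
    refine le_trans (le_of_eq (lintegral_congr fun x => ?_)) (hB j hj)
    rw [enorm_pow, ← ENNReal.rpow_natCast, ← ENNReal.rpow_mul]
    congr 1
    push_cast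
    ring
  have hsum := (eLpNorm_sum_le (μ := μ) (f := fun j x => a j x ^ 2) (s := s)
    (fun j _ => ((ha j).pow_const 2).aestronglyMeasurable) hone).trans (Finset.sum_le_sum hterm)
  rw [eLpNorm_eq_lintegral_rpow_enorm_toReal hne ENNReal.ofReal_ne_top, htr, one_div,
    ENNReal.rpow_inv_le_iff hq2] at hsum
  refine le_trans (le_of_eq (lintegral_congr fun x => ?_)) hsum
  rw [Finset.sum_apply, Real.enorm_eq_ofReal (Finset.sum_nonneg fun _ _ => sq_nonneg _)]

theorem exists_lintegral_lacunaryPoly_rpow_le {q : ℝ} (hq : 2 ≤ q) :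
    ∃ K : ℝ≥0∞, K ≠ ⊤ ∧ ∀ (N : ℕ) (c : ℕ → ℕ → ℝ),
      ∫⁻ z, ‖lacunaryPoly c N z‖ₑ ^ q ∂squareMeasure ≤
        K * ENNReal.ofReal (sqSum c N) ^ (q / 2) := by
  have hq0 : 0 < q := by linarith
  have hq2 : 0 < q / 2 := by linarith
  obtain ⟨K, hK, h1⟩ := exists_lintegral_sum_cos_two_pow_rpow_le hq0
  refine ⟨K * K, ENNReal.mul_ne_top hK hK, fun N c => ?_⟩
  set a : ℕ → ℝ → ℝ := fun j x => ∑ i ∈ Finset.range N, c i j * cos (2 ^ i * x) with ha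
  have hac : ∀ j, Continuous (a j) := fun j => by fun_prop
  rw [lintegral_prod _ (by
    have := continuous_lacunaryPoly c N
    exact (this.measurable.enorm.pow_const q).aemeasurable)]
  calc ∫⁻ x, ∫⁻ y, ‖lacunaryPoly c N (x, y)‖ₑ ^ q ∂periodMeasure ∂periodMeasure
      ≤ ∫⁻ x, K * ENNReal.ofReal (∑ j ∈ Finset.range N, a j x ^ 2) ^ (q / 2) ∂periodMeasure :=
        lintegral_mono fun x => h1 N fun j => a j x
    _ = K * ∫⁻ x, ENNReal.ofReal (∑ j ∈ Finset.range N, a j x ^ 2) ^ (q / 2) ∂periodMeasure :=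
        lintegral_const_mul _ (by fun_prop)
    _ ≤ K * (∑ j ∈ Finset.range N, K ^ (q / 2)⁻¹ *
          ENNReal.ofReal (∑ i ∈ Finset.range N, c i j ^ 2)) ^ (q / 2) := by
        refine mul_le_mul_right (lintegral_sum_sq_rpow_le hq _ a (fun j => (hac j).measurable) _
          fun j _ => ?_) _
        rw [ENNReal.mul_rpow_of_nonneg _ _ hq2.le, ENNReal.rpow_inv_rpow hq2.ne']
        exact h1 N fun i => c i j
    _ = K * K * ENNReal.ofReal (sqSum c N) ^ (q / 2) := by
        rw [← Finset.mul_sum, ENNReal.mul_rpow_of_nonneg _ _ hq2.le,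
          ENNReal.rpow_inv_rpow hq2.ne', sqSum, ENNReal.ofReal_sum_of_nonneg
            fun j _ => Finset.sum_nonneg fun i _ => sq_nonneg (c i j), mul_assoc]

theorem exists_eLpNorm_lacunaryPoly_le {r : ℝ} (hr : 1 ≤ r) :
    ∃ C : ℝ, 0 < C ∧ ∀ (N : ℕ) (c : ℕ → ℕ → ℝ),
      eLpNorm (lacunaryPoly c N) (ENNReal.ofReal r) squareMeasure ≤
        ENNReal.ofReal (C * √(sqSum c N)) := by
  set q := max r 2 with hq
  have hq2 : 2 ≤ q := le_max_right _ _
  have hq0 : 0 < q := by linarith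
  obtain ⟨K, hK, h⟩ := exists_lintegral_lacunaryPoly_rpow_le hq2
  set V : ℝ≥0∞ := squareMeasure Set.univ ^
    (1 / (ENNReal.ofReal r).toReal - 1 / (ENNReal.ofReal q).toReal) with hV
  have hVt : V ≠ ⊤ := by
    refine ENNReal.rpow_ne_top_of_nonneg ?_ (measure_ne_top _ _)
    rw [ENNReal.toReal_ofReal hq0.le, ENNReal.toReal_ofReal (by linarith), sub_nonneg]
    exact one_div_le_one_div_of_le (by linarith) (le_max_left _ _)
  have hKt : K ^ q⁻¹ * V ≠ ⊤ :=
    ENNReal.mul_ne_top (ENNReal.rpow_ne_top_of_nonneg (by positivity) hK) hVt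
  refine ⟨(K ^ q⁻¹ * V).toReal + 1, by positivity, fun N c => ?_⟩
  have hm := (continuous_lacunaryPoly c N).aestronglyMeasurable (μ := squareMeasure)
  have hLq : eLpNorm (lacunaryPoly c N) (ENNReal.ofReal q) squareMeasure ≤
      K ^ q⁻¹ * ENNReal.ofReal (√(sqSum c N)) := by
    rw [eLpNorm_eq_lintegral_rpow_enorm_toReal (by simpa using hq0) ENNReal.ofReal_ne_top,
      ENNReal.toReal_ofReal hq0.le, one_div, ENNReal.rpow_inv_le_iff hq0,
      ENNReal.mul_rpow_of_nonneg _ _ hq0.le, ENNReal.rpow_inv_rpow hq0.ne', Real.sqrt_eq_rpow,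
      ← ENNReal.ofReal_rpow_of_nonneg (sqSum_nonneg c N) (by norm_num), ← ENNReal.rpow_mul,
      one_div_mul_eq_div]
    exact h N c
  calc eLpNorm (lacunaryPoly c N) (ENNReal.ofReal r) squareMeasure
      ≤ eLpNorm (lacunaryPoly c N) (ENNReal.ofReal q) squareMeasure * V :=
        eLpNorm_le_eLpNorm_mul_rpow_measure_univ
          (ENNReal.ofReal_le_ofReal (le_max_left _ _)) hm
    _ ≤ K ^ q⁻¹ * ENNReal.ofReal (√(sqSum c N)) * V := mul_le_mul_left hLq _
    _ = ENNReal.ofReal ((K ^ q⁻¹ * V).toReal) * ENNReal.ofReal (√(sqSum c N)) := by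
        rw [ENNReal.ofReal_toReal hKt]; ring
    _ ≤ _ := by
        rw [← ENNReal.ofReal_mul (by positivity)]
        exact ENNReal.ofReal_le_ofReal
          (mul_le_mul_of_nonneg_right (by linarith) (sqrt_nonneg _))

theorem integral_mul_continuousMap_eq_zero [Fact (0 < 2 * π)] {h : ℝ → ℝ}
    (hi : Integrable h periodMeasure)
    (hcos : ∀ n : ℕ, ∫ x, h x * cos (n * x) ∂periodMeasure = 0)
    (hsin : ∀ n : ℕ, ∫ x, h x * sin (n * x) ∂periodMeasure = 0)
    (G : C(AddCircle (2 * π), ℂ)) :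
    ∫ x, (h x : ℂ) * G (x : AddCircle (2 * π)) ∂periodMeasure = 0 := by
  have hint : ∀ G : C(AddCircle (2 * π), ℂ),
      Integrable (fun x : ℝ => (h x : ℂ) * G (x : AddCircle (2 * π))) periodMeasure := by
    intro G
    refine hi.ofReal.mul_bdd (c := ‖G‖) ?_ (Filter.Eventually.of_forall fun x => G.norm_coe_le_norm _)
    exact (G.continuous.comp (AddCircle.continuous_mk' _)).aestronglyMeasurable
  let L : C(AddCircle (2 * π), ℂ) →ₗ[ℂ] ℂ :=
    { toFun := fun G => ∫ x, (h x : ℂ) * G (x : AddCircle (2 * π)) ∂periodMeasure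
      map_add' := fun F G => by
        simp only [ContinuousMap.add_apply, mul_add]
        exact integral_add (hint F) (hint G)
      map_smul' := fun k G => by
        simp only [ContinuousMap.smul_apply, smul_eq_mul, RingHom.id_apply]
        rw [← integral_const_mul]
        exact integral_congr_ae (Filter.Eventually.of_forall fun x => by ring) }
  have hbound : ∀ G, ‖L G‖ ≤ (∫ x, ‖h x‖ ∂periodMeasure) * ‖G‖ := by
    intro G
    rw [← integral_mul_const]
    refine norm_integral_le_of_norm_le (hi.norm.mul_const _) (Filter.Eventually.of_forall fun x => ?_)
    rw [norm_mul, Complex.norm_real]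
    exact mul_le_mul_of_nonneg_left (G.norm_coe_le_norm _) (norm_nonneg _)
  have hzero : L.mkContinuous _ hbound = 0 := by
    refine ContinuousLinearMap.ext_on
      (Submodule.dense_iff_topologicalClosure_eq_top.2 span_fourier_closure_eq_top) ?_
    rintro _ ⟨n, rfl⟩
    have hI : ∀ k : ℝ, Integrable (fun x => h x * cos (k * x)) periodMeasure := fun k =>
      hi.mul_bdd (c := 1) (by fun_prop)
        (Filter.Eventually.of_forall fun x => abs_cos_le_one _)
    have hJ : ∀ k : ℝ, Integrable (fun x => h x * sin (k * x)) periodMeasure := fun k =>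
      hi.mul_bdd (c := 1) (by fun_prop)
        (Filter.Eventually.of_forall fun x => abs_sin_le_one _)
    have hexp : ∀ x : ℝ, (h x : ℂ) * fourier n (x : AddCircle (2 * π)) =
        ((h x * cos (n * x) : ℝ) : ℂ) + ((h x * sin (n * x) : ℝ) : ℂ) * Complex.I := by
      intro x
      have hpi : (π : ℂ) ≠ 0 := Complex.ofReal_ne_zero.2 pi_ne_zero
      have harg : 2 * π * Complex.I * n * x / ((2 * π : ℝ) : ℂ) =
          ((n * x : ℝ) : ℂ) * Complex.I := by
        push_cast
        field_simp
      rw [fourier_coe_apply, harg, Complex.exp_mul_I]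
      push_cast
      ring
    have hc : ∫ x, h x * cos (n * x) ∂periodMeasure = 0 := by
      obtain ⟨k, rfl | rfl⟩ := n.eq_nat_or_neg
      · exact_mod_cast hcos k
      · simpa using hcos k
    have hs : ∫ x, h x * sin (n * x) ∂periodMeasure = 0 := by
      obtain ⟨k, rfl | rfl⟩ := n.eq_nat_or_neg
      · exact_mod_cast hsin k
      · simpa [integral_neg] using hsin k
    change ∫ x, (h x : ℂ) * fourier n (x : AddCircle (2 * π)) ∂periodMeasure = 0
    simp_rw [hexp]
    rw [integral_add (hI n).ofReal ((hJ n).ofReal.mul_const _), integral_mul_const]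
    simp only [integral_complex_ofReal, hc, hs]
    simp
  exact congrArg (fun M => M G) hzero

theorem ae_eq_zero_of_integral_mul_cos_sin_eq_zero {h : ℝ → ℝ}
    (hi : Integrable h periodMeasure)
    (hcos : ∀ n : ℕ, ∫ x, h x * cos (n * x) ∂periodMeasure = 0)
    (hsin : ∀ n : ℕ, ∫ x, h x * sin (n * x) ∂periodMeasure = 0) :
    h =ᵐ[periodMeasure] 0 := by
  have : Fact (0 < 2 * π) := ⟨two_pi_pos⟩
  have hon : IntegrableOn h (Set.Ioo 0 (2 * π)) := hi.mono_measure
    (Measure.restrict_mono Set.Ioo_subset_Ioc_self le_rfl)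
  have key := isOpen_Ioo.ae_eq_zero_of_integral_contDiff_smul_eq_zero (μ := volume)
    hon.locallyIntegrableOn fun g hg _ hsupp => by
      have hvan : ∀ x, x ∉ Set.Ioo 0 (2 * π) → g x = 0 := fun x hx =>
        image_eq_zero_of_notMem_tsupport fun hx' => hx (hsupp hx')
      let G : C(AddCircle (2 * π), ℂ) :=
        ⟨AddCircle.liftIco (2 * π) 0 fun x => (g x : ℂ), AddCircle.liftIco_zero_continuous
          (by rw [hvan 0 (by simp), hvan (2 * π) (by simp)])
          (Complex.continuous_ofReal.comp hg.continuous).continuousOn⟩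
      have h0 := integral_mul_continuousMap_eq_zero hi hcos hsin G
      rw [integral_Ioc_eq_integral_Ioo, setIntegral_congr_fun (g := fun x => ((g x * h x : ℝ) : ℂ))
        measurableSet_Ioo fun x hx => by
          change (h x : ℂ) * AddCircle.liftIco (2 * π) 0 (fun x => (g x : ℂ)) x = _
          rw [AddCircle.liftIco_coe_apply (by simpa using ⟨hx.1.le, hx.2⟩)]
          push_cast
          ring] at h0
      rw [integral_complex_ofReal, Complex.ofReal_eq_zero] at h0
      rw [← h0]
      refine (setIntegral_eq_integral_of_forall_compl_eq_zero fun x hx => ?_).symm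
      rw [hvan x hx, zero_smul]
  rw [Filter.EventuallyEq, periodMeasure, ← Measure.restrict_congr_set Ioo_ae_eq_Ioc,
    ae_restrict_iff' measurableSet_Ioo]
  exact key

/-- The trigonometric system: `cos (n x)` for `false` and `sin (n x)` for `true`. -/
def trig (s : Bool) (n : ℕ) (x : ℝ) : ℝ := if s then sin (n * x) else cos (n * x)

@[fun_prop]
theorem continuous_trig (s : Bool) (n : ℕ) : Continuous (trig s n) := by
  unfold trig
  cases s <;> simp <;> fun_prop

theorem abs_trig_le_one (s : Bool) (n : ℕ) (x : ℝ) : |trig s n x| ≤ 1 := by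
  cases s
  · simpa [trig] using abs_cos_le_one (n * x)
  · simpa [trig] using abs_sin_le_one (n * x)

/-- The integral of `f` against a product of two elements of the trigonometric system. -/
def trigCoeff (f : ℝ × ℝ → ℝ) (s : Bool) (n : ℕ) (t : Bool) (m : ℕ) : ℝ :=
  ∫ z, f z * (trig s n z.1 * trig t m z.2) ∂squareMeasure

theorem norm_trig_mul_trig_le_one (s : Bool) (n : ℕ) (t : Bool) (m : ℕ) (z : ℝ × ℝ) :
    ‖trig s n z.1 * trig t m z.2‖ ≤ 1 := by
  rw [norm_mul]
  exact mul_le_one₀ (abs_trig_le_one _ _ _) (norm_nonneg _) (abs_trig_le_one _ _ _)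

theorem MeasureTheory.Integrable.mul_trig {h : ℝ × ℝ → ℝ} (hi : Integrable h squareMeasure)
    (s : Bool) (n : ℕ) (t : Bool) (m : ℕ) :
    Integrable (fun z => h z * (trig s n z.1 * trig t m z.2)) squareMeasure :=
  hi.mul_bdd (c := 1) (Continuous.aestronglyMeasurable (by fun_prop))
    (Filter.Eventually.of_forall fun z => norm_trig_mul_trig_le_one s n t m z)

theorem ae_eq_zero_of_integral_mul_trig {h : ℝ → ℝ} (hi : Integrable h periodMeasure)
    (h0 : ∀ s n, ∫ x, h x * trig s n x ∂periodMeasure = 0) : h =ᵐ[periodMeasure] 0 :=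
  ae_eq_zero_of_integral_mul_cos_sin_eq_zero hi (fun n => by simpa [trig] using h0 false n)
    (fun n => by simpa [trig] using h0 true n)

theorem ae_eq_zero_of_trigCoeff_eq_zero {h : ℝ × ℝ → ℝ} (hi : Integrable h squareMeasure)
    (h0 : ∀ s n t m, trigCoeff h s n t m = 0) : h =ᵐ[squareMeasure] 0 := by
  have hinner : ∀ t m, ∀ᵐ x ∂periodMeasure, ∫ y, h (x, y) * trig t m y ∂periodMeasure = 0 := by
    intro t m
    have hi' : Integrable (fun z : ℝ × ℝ => h z * trig t m z.2) squareMeasure :=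
      hi.mul_bdd (c := 1) (Continuous.aestronglyMeasurable (by fun_prop))
        (Filter.Eventually.of_forall fun z => abs_trig_le_one t m z.2)
    refine ae_eq_zero_of_integral_mul_trig hi'.integral_prod_left fun s n => ?_
    rw [← h0 s n t m, trigCoeff, integral_prod _ (hi.mul_trig s n t m)]
    refine integral_congr_ae (Filter.Eventually.of_forall fun x => ?_)
    simp only
    rw [← integral_mul_const]
    exact integral_congr_ae (Filter.Eventually.of_forall fun y => by ring)
  have hall : ∀ᵐ x ∂periodMeasure, ∀ t m, ∫ y, h (x, y) * trig t m y ∂periodMeasure = 0 := by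
    rw [ae_all_iff]
    exact fun t => ae_all_iff.2 fun m => hinner t m
  have hz : ∀ᵐ x ∂periodMeasure, (fun y => h (x, y)) =ᵐ[periodMeasure] 0 := by
    filter_upwards [hall, hi.prod_right_ae] with x hx hxi
    exact ae_eq_zero_of_integral_mul_trig hxi hx
  have hl : ∫⁻ z, ‖h z‖ₑ ∂squareMeasure = 0 := by
    rw [lintegral_prod _ hi.aestronglyMeasurable.enorm, lintegral_eq_zero_of_ae_eq_zero]
    filter_upwards [hz] with x hx
    exact lintegral_eq_zero_of_ae_eq_zero (hx.mono fun y hy => by simp [hy])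
  rw [lintegral_eq_zero_iff' hi.aestronglyMeasurable.enorm] at hl
  exact hl.mono fun z hz => by simpa using hz

theorem integral_cos_int_mul {k : ℤ} (hk : k ≠ 0) :
    ∫ x in (0:ℝ)..(2 * π), cos (k * x) = 0 := by
  have hk' : (k : ℝ) ≠ 0 := Int.cast_ne_zero.2 hk
  rw [intervalIntegral.integral_comp_mul_left _ hk', integral_cos, mul_zero, sin_zero]
  have : sin (k * (2 * π)) = 0 := by
    rw [← mul_assoc, mul_comm (k : ℝ) 2]
    exact_mod_cast sin_int_mul_pi (2 * k)
  simp [this]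

theorem integral_cos_mul_cos {m : ℕ} (hm : m ≠ 0) (n : ℕ) :
    ∫ x, cos (m * x) * cos (n * x) ∂periodMeasure = if n = m then π else 0 := by
  rw [← intervalIntegral.integral_of_le two_pi_pos.le]
  have hprod : ∀ x : ℝ, cos (m * x) * cos (n * x) =
      (cos (((m - n : ℤ) : ℝ) * x) + cos (((m + n : ℤ) : ℝ) * x)) / 2 := by
    intro x
    push_cast
    rw [sub_mul, add_mul, cos_sub, cos_add]
    ring
  simp_rw [hprod]
  rw [intervalIntegral.integral_div, intervalIntegral.integral_add
    (Continuous.intervalIntegrable (by fun_prop) _ _)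
    (Continuous.intervalIntegrable (by fun_prop) _ _), integral_cos_int_mul (k := m + n) (by omega)]
  split_ifs with h
  · subst h
    simp
  · rw [integral_cos_int_mul (by omega)]
    simp

theorem integral_cos_mul_sin (m n : ℕ) :
    ∫ x, cos (m * x) * sin (n * x) ∂periodMeasure = 0 := by
  rw [← intervalIntegral.integral_of_le two_pi_pos.le]
  have h := intervalIntegral.integral_comp_sub_left (a := 0) (b := 2 * π)
    (fun x => cos (m * x) * sin (n * x)) (2 * π)
  have hodd : ∀ x : ℝ, cos (m * (2 * π - x)) * sin (n * (2 * π - x)) =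
      -(cos (m * x) * sin (n * x)) := by
    intro x
    rw [mul_sub, mul_sub, cos_nat_mul_two_pi_sub, sin_nat_mul_two_pi_sub]
    ring
  simp_rw [hodd] at h
  rw [intervalIntegral.integral_neg, sub_self, sub_zero] at h
  linarith

theorem integral_cos_two_pow_mul_trig (i : ℕ) (s : Bool) (n : ℕ) :
    ∫ x, cos (2 ^ i * x) * trig s n x ∂periodMeasure =
      if s = false ∧ n = 2 ^ i then π else 0 := by
  cases s
  · have h := integral_cos_mul_cos (m := 2 ^ i) (by positivity) n
    push_cast at h
    simpa [trig] using h
  · have h := integral_cos_mul_sin (2 ^ i) n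
    push_cast at h
    simpa [trig] using h

theorem trigCoeff_lacunaryPoly (c : ℕ → ℕ → ℝ) (N : ℕ) (s : Bool) (n : ℕ) (t : Bool) (m : ℕ) :
    trigCoeff (lacunaryPoly c N) s n t m =
      ∑ j ∈ Finset.range N, ∑ i ∈ Finset.range N, c i j *
        ((if s = false ∧ n = 2 ^ i then π else 0) * (if t = false ∧ m = 2 ^ j then π else 0)) := by
  have hexp : ∀ z : ℝ × ℝ, lacunaryPoly c N z * (trig s n z.1 * trig t m z.2) =
      ∑ j ∈ Finset.range N, ∑ i ∈ Finset.range N, c i j *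
        ((cos (2 ^ i * z.1) * trig s n z.1) * (cos (2 ^ j * z.2) * trig t m z.2)) := by
    intro z
    simp only [lacunaryPoly, Finset.sum_mul]
    refine Finset.sum_congr rfl fun j _ => Finset.sum_congr rfl fun i _ => by ring
  have hcos : ∀ i s n, Integrable (fun x : ℝ => cos (2 ^ i * x) * trig s n x) periodMeasure :=
    fun i s n => (intervalIntegrable_iff_integrableOn_Ioc_of_le two_pi_pos.le).1
      (Continuous.intervalIntegrable (by fun_prop) _ _)
  have hint : ∀ i j, Integrable (fun z : ℝ × ℝ => c i j *
      ((cos (2 ^ i * z.1) * trig s n z.1) * (cos (2 ^ j * z.2) * trig t m z.2))) squareMeasure :=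
    fun i j => ((hcos i s n).mul_prod (hcos j t m)).const_mul _
  simp_rw [trigCoeff, hexp]
  rw [integral_finsetSum _ fun j _ => integrable_finsetSum _ fun i _ => hint i j]
  refine Finset.sum_congr rfl fun j _ => ?_
  rw [integral_finsetSum _ fun i _ => hint i j]
  refine Finset.sum_congr rfl fun i _ => ?_
  rw [integral_const_mul, integral_prod_mul (fun x => cos (2 ^ i * x) * trig s n x)
    (fun y => cos (2 ^ j * y) * trig t m y), integral_cos_two_pow_mul_trig,
    integral_cos_two_pow_mul_trig]

theorem sum_range_sub_sum_range {N M : ℕ} (hNM : N ≤ M) (F : ℕ → ℕ → ℝ) :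
    ∑ j ∈ Finset.range M, ∑ i ∈ Finset.range M, F i j -
      ∑ j ∈ Finset.range N, ∑ i ∈ Finset.range N, F i j =
    ∑ j ∈ Finset.range M, ∑ i ∈ Finset.range M, if i < N ∧ j < N then 0 else F i j := by
  have hsub : Finset.range N ⊆ Finset.range M := Finset.range_subset_range.2 hNM
  have h : ∑ j ∈ Finset.range N, ∑ i ∈ Finset.range N, F i j =
      ∑ j ∈ Finset.range M, ∑ i ∈ Finset.range M, if i < N ∧ j < N then F i j else 0 := by
    rw [← Finset.sum_subset hsub fun j _ hj => ?_]
    · refine Finset.sum_congr rfl fun j hj => ?_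
      rw [← Finset.sum_subset hsub fun i _ hi => ?_]
      · refine Finset.sum_congr rfl fun i hi => ?_
        rw [if_pos ⟨Finset.mem_range.1 hi, Finset.mem_range.1 hj⟩]
      · rw [if_neg fun h => hi (Finset.mem_range.2 h.1)]
    · exact Finset.sum_eq_zero fun i _ => if_neg fun h => hj (Finset.mem_range.2 h.2)
  rw [h, ← Finset.sum_sub_distrib]
  refine Finset.sum_congr rfl fun j _ => ?_
  rw [← Finset.sum_sub_distrib]
  refine Finset.sum_congr rfl fun i _ => ?_
  split_ifs <;> simp

theorem lacunaryPoly_sub (c : ℕ → ℕ → ℝ) {N M : ℕ} (hNM : N ≤ M) :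
    lacunaryPoly c M - lacunaryPoly c N =
      lacunaryPoly (fun i j => if i < N ∧ j < N then 0 else c i j) M := by
  ext z
  simp only [Pi.sub_apply, lacunaryPoly, Finset.sum_mul]
  rw [sum_range_sub_sum_range hNM fun i j => c i j * cos (2 ^ i * z.1) * cos (2 ^ j * z.2)]
  refine Finset.sum_congr rfl fun j _ => Finset.sum_congr rfl fun i _ => ?_
  split_ifs <;> simp

theorem sqSum_sub (c : ℕ → ℕ → ℝ) {N M : ℕ} (hNM : N ≤ M) :
    sqSum c M - sqSum c N = sqSum (fun i j => if i < N ∧ j < N then 0 else c i j) M := by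
  rw [sqSum, sqSum, sum_range_sub_sum_range hNM fun i j => c i j ^ 2, sqSum]
  refine Finset.sum_congr rfl fun j _ => Finset.sum_congr rfl fun i _ => ?_
  split_ifs <;> simp

theorem monotone_sqSum (c : ℕ → ℕ → ℝ) : Monotone (sqSum c) := fun _ _ hNM =>
  sub_nonneg.1 ((sqSum_nonneg _ _).trans_eq (sqSum_sub c hNM).symm)

theorem exists_tendsto_eLpNorm_lacunaryPoly_sub {r B : ℝ} (hr : 1 ≤ r) {c : ℕ → ℕ → ℝ}
    (hB : ∀ N, sqSum c N ≤ B) :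
    ∃ g : ℝ × ℝ → ℝ, MemLp g (ENNReal.ofReal r) squareMeasure ∧
      Filter.Tendsto (fun N => eLpNorm (lacunaryPoly c N - g) (ENNReal.ofReal r) squareMeasure)
        Filter.atTop (nhds 0) := by
  obtain ⟨C, hC, hbound⟩ := exists_eLpNorm_lacunaryPoly_le hr
  have : Fact (1 ≤ ENNReal.ofReal r) := ⟨by rwa [ENNReal.one_le_ofReal]⟩
  have hmem : ∀ N, MemLp (lacunaryPoly c N) (ENNReal.ofReal r) squareMeasure := fun N =>
    ⟨(continuous_lacunaryPoly c N).aestronglyMeasurable,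
      (hbound N c).trans_lt ENNReal.ofReal_lt_top⟩
  set u : ℕ → Lp ℝ (ENNReal.ofReal r) squareMeasure := fun N => (hmem N).toLp with hu
  have hlim := tendsto_atTop_ciSup (monotone_sqSum c) ⟨B, Set.forall_mem_range.2 hB⟩
  have hcauchy : CauchySeq u := by
    refine cauchySeq_of_le_tendsto_0' (fun N => C * √((⨆ N, sqSum c N) - sqSum c N))
      (fun N M hNM => ?_) ?_
    · rw [dist_comm, dist_eq_norm, hu, ← MemLp.toLp_sub, Lp.norm_toLp]
      refine ENNReal.toReal_le_of_le_ofReal (by positivity) ?_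
      rw [lacunaryPoly_sub c hNM]
      refine (hbound M _).trans (ENNReal.ofReal_le_ofReal ?_)
      rw [← sqSum_sub c hNM]
      gcongr
      exact le_ciSup ⟨B, Set.forall_mem_range.2 hB⟩ M
    · have h := ((tendsto_const_nhds (x := ⨆ N, sqSum c N)).sub hlim).sqrt.const_mul C
      simpa using h
  obtain ⟨g, hg⟩ := cauchySeq_tendsto_of_complete hcauchy
  refine ⟨g, Lp.memLp g, ?_⟩
  rw [Lp.tendsto_Lp_iff_tendsto_eLpNorm'] at hg
  refine hg.congr fun N => eLpNorm_congr_ae ?_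
  exact (MemLp.coeFn_toLp (hmem N)).sub (Filter.EventuallyEq.refl _ _)

theorem tendsto_trigCoeff {r : ℝ} (hr : 1 ≤ r) {P : ℕ → ℝ × ℝ → ℝ} {g : ℝ × ℝ → ℝ}
    (hP : ∀ N, MemLp (P N) (ENNReal.ofReal r) squareMeasure)
    (hg : MemLp g (ENNReal.ofReal r) squareMeasure)
    (hlim : Filter.Tendsto (fun N => eLpNorm (P N - g) (ENNReal.ofReal r) squareMeasure)
      Filter.atTop (nhds 0)) (s : Bool) (n : ℕ) (t : Bool) (m : ℕ) :
    Filter.Tendsto (fun N => trigCoeff (P N) s n t m) Filter.atTop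
      (nhds (trigCoeff g s n t m)) := by
  have h1 : 1 ≤ ENNReal.ofReal r := by rwa [ENNReal.one_le_ofReal]
  refine tendsto_integral_of_L1' _ ((hg.integrable h1).mul_trig s n t m).aestronglyMeasurable
    (Filter.Eventually.of_forall fun N => ((hP N).integrable h1).mul_trig s n t m) ?_
  set V : ℝ≥0∞ := squareMeasure Set.univ ^
    (1 / (1 : ℝ≥0∞).toReal - 1 / (ENNReal.ofReal r).toReal) with hV
  have hVt : V ≠ ⊤ := by
    refine ENNReal.rpow_ne_top_of_nonneg ?_ (measure_ne_top _ _)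
    rw [ENNReal.toReal_ofReal (by linarith), ENNReal.toReal_one, sub_nonneg]
    exact one_div_le_one_div_of_le one_pos hr
  have hz := ENNReal.Tendsto.mul_const (b := V) hlim (Or.inr hVt)
  rw [zero_mul] at hz
  refine tendsto_of_tendsto_of_tendsto_of_le_of_le tendsto_const_nhds hz (fun _ => zero_le)
    fun N => ?_
  refine le_trans (eLpNorm_mono fun z => ?_) (eLpNorm_le_eLpNorm_mul_rpow_measure_univ h1
    ((hP N).sub hg).aestronglyMeasurable)
  rw [Pi.sub_apply, Pi.sub_apply, ← sub_mul, norm_mul]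
  exact mul_le_of_le_one_right (norm_nonneg _) (norm_trig_mul_trig_le_one s n t m z)

theorem Lp2Norm_eq_eLpNorm {p : ℝ} (hp : 0 < p) {f : ℝ → ℝ → ℝ}
    (hf : Measurable (Function.uncurry f)) :
    Lp2Norm p f = eLpNorm (Function.uncurry f) (ENNReal.ofReal p) squareMeasure := by
  rw [eLpNorm_eq_lintegral_rpow_enorm_toReal (by simpa using hp) ENNReal.ofReal_ne_top,
    ENNReal.toReal_ofReal hp.le, lintegral_prod _ (hf.enorm.pow_const p).aemeasurable, Lp2Norm]
  congr 1
  refine lintegral_congr fun x => lintegral_congr fun y => ?_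
  rw [Function.uncurry_apply_pair, Real.enorm_eq_ofReal_abs,
    ENNReal.ofReal_rpow_of_nonneg (abs_nonneg _) hp.le]

theorem MemLp0.memLp {p : ℝ} (hp : 0 < p) {f : ℝ → ℝ → ℝ} (hf : MemLp0 p f) :
    MemLp (Function.uncurry f) (ENNReal.ofReal p) squareMeasure :=
  ⟨hf.meas.aestronglyMeasurable, by
    rw [← Lp2Norm_eq_eLpNorm hp hf.meas]
    exact hf.norm_ne_top.lt_top⟩

theorem trigCoeff_uncurry {f : ℝ → ℝ → ℝ} (hi : Integrable (Function.uncurry f) squareMeasure)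
    (s : Bool) (n : ℕ) (t : Bool) (m : ℕ) :
    trigCoeff (Function.uncurry f) s n t m =
      ∫ x in (0:ℝ)..(2 * π), ∫ y in (0:ℝ)..(2 * π), f x y * trig s n x * trig t m y := by
  rw [trigCoeff, integral_prod _ (hi.mul_trig s n t m)]
  simp only [intervalIntegral.integral_of_le two_pi_pos.le, Function.uncurry_apply_pair, mul_assoc]

theorem InLambdaClass.trigCoeff_two_pow {p : ℝ} (hp : 1 < p) {f : ℝ → ℝ → ℝ} {lam : ℕ → ℕ → ℝ}
    (h : InLambdaClass p f lam) (i j : ℕ) :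
    trigCoeff (Function.uncurry f) false (2 ^ i) false (2 ^ j) = π ^ 2 * lam i j := by
  have hi := (h.1.memLp (by linarith)).integrable (ENNReal.one_le_ofReal.2 hp.le)
  rw [trigCoeff_uncurry hi, ← h.2.1 i j, fourierCC, ← mul_assoc, mul_one_div_cancel (by positivity),
    one_mul]
  simp [trig]

theorem InLambdaClass.trigCoeff_eq_zero {p : ℝ} (hp : 1 < p) {f : ℝ → ℝ → ℝ} {lam : ℕ → ℕ → ℝ}
    (h : InLambdaClass p f lam) {s : Bool} {n : ℕ} {t : Bool} {m : ℕ}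
    (hn : ¬ ∃ i j : ℕ, (s = false ∧ n = 2 ^ i) ∧ (t = false ∧ m = 2 ^ j)) :
    trigCoeff (Function.uncurry f) s n t m = 0 := by
  have hi := (h.1.memLp (by linarith)).integrable (ENNReal.one_le_ofReal.2 hp.le)
  have hpi : (1 / π ^ 2 : ℝ) ≠ 0 := by positivity
  obtain ⟨hSC, hCS, hSS⟩ := h.2.2.2 n m
  rw [trigCoeff_uncurry hi]
  cases s <;> cases t
  · have hCC := h.2.2.1 n m fun ⟨i, j, hni, hmj⟩ => hn ⟨i, j, ⟨rfl, hni⟩, rfl, hmj⟩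
    simpa [trig] using (mul_eq_zero.1 hCC).resolve_left hpi
  · simpa [trig] using (mul_eq_zero.1 hCS).resolve_left hpi
  · simpa [trig] using (mul_eq_zero.1 hSC).resolve_left hpi
  · simpa [trig] using (mul_eq_zero.1 hSS).resolve_left hpi

theorem InLambdaClass.eventually_trigCoeff_eq {p : ℝ} (hp : 1 < p) {f : ℝ → ℝ → ℝ}
    {lam : ℕ → ℕ → ℝ} (h : InLambdaClass p f lam) (s : Bool) (n : ℕ) (t : Bool) (m : ℕ) :
    ∀ᶠ N in Filter.atTop,
      trigCoeff (lacunaryPoly lam N) s n t m = trigCoeff (Function.uncurry f) s n t m := by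
  by_cases hn : ∃ i j : ℕ, (s = false ∧ n = 2 ^ i) ∧ (t = false ∧ m = 2 ^ j)
  · obtain ⟨k, l, ⟨rfl, rfl⟩, rfl, rfl⟩ := hn
    filter_upwards [Filter.eventually_gt_atTop k, Filter.eventually_gt_atTop l] with N hk hl
    rw [trigCoeff_lacunaryPoly, h.trigCoeff_two_pow hp,
      Finset.sum_eq_single_of_mem l (Finset.mem_range.2 hl),
      Finset.sum_eq_single_of_mem k (Finset.mem_range.2 hk)]
    · simp only [true_and, if_true]
      ring
    · intro i _ hik
      rw [if_neg fun h' => hik (Nat.pow_right_injective le_rfl h'.2).symm]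
      ring
    · intro j _ hjl
      refine Finset.sum_eq_zero fun i _ => ?_
      rw [if_neg (c := _ ∧ 2 ^ l = 2 ^ j) fun h' => hjl (Nat.pow_right_injective le_rfl h'.2).symm]
      ring
  · refine Filter.Eventually.of_forall fun N => ?_
    rw [h.trigCoeff_eq_zero hp hn, trigCoeff_lacunaryPoly]
    refine Finset.sum_eq_zero fun j _ => Finset.sum_eq_zero fun i _ => ?_
    split_ifs with h1 h2
    · exact absurd ⟨i, j, h1, h2⟩ hn
    all_goals simp

theorem InLambdaClass.integral_mul_lacunaryPoly {p : ℝ} (hp : 1 < p) {f : ℝ → ℝ → ℝ}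
    {lam : ℕ → ℕ → ℝ} (h : InLambdaClass p f lam) (N : ℕ) :
    ∫ z, Function.uncurry f z * lacunaryPoly lam N z ∂squareMeasure = π ^ 2 * sqSum lam N := by
  have hi := (h.1.memLp (by linarith)).integrable (ENNReal.one_le_ofReal.2 hp.le)
  have hexp : ∀ z : ℝ × ℝ, Function.uncurry f z * lacunaryPoly lam N z =
      ∑ j ∈ Finset.range N, ∑ i ∈ Finset.range N, lam i j *
        (Function.uncurry f z * (trig false (2 ^ i) z.1 * trig false (2 ^ j) z.2)) := by
    intro z
    simp only [lacunaryPoly, Finset.sum_mul, Finset.mul_sum]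
    refine Finset.sum_congr rfl fun j _ => Finset.sum_congr rfl fun i _ => ?_
    simp only [trig, Bool.false_eq_true, if_false]
    push_cast
    ring
  have hint := fun i j => (hi.mul_trig false (2 ^ i) false (2 ^ j)).const_mul (lam i j)
  simp_rw [hexp]
  rw [integral_finsetSum _ fun j _ => integrable_finsetSum _ fun i _ => hint i j, sqSum,
    Finset.mul_sum]
  refine Finset.sum_congr rfl fun j _ => ?_
  rw [integral_finsetSum _ fun i _ => hint i j, Finset.mul_sum]
  refine Finset.sum_congr rfl fun i _ => ?_
  rw [integral_const_mul]
  change lam i j * trigCoeff (Function.uncurry f) false (2 ^ i) false (2 ^ j) = _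
  rw [h.trigCoeff_two_pow hp]
  ring

theorem ofReal_sqSum_le_tsum (c : ℕ → ℕ → ℝ) (N : ℕ) :
    ENNReal.ofReal (sqSum c N) ≤ ∑' (i : ℕ) (j : ℕ), ENNReal.ofReal (c i j ^ 2) := by
  rw [sqSum, Finset.sum_comm, ENNReal.ofReal_sum_of_nonneg
    fun i _ => Finset.sum_nonneg fun j _ => sq_nonneg (c i j)]
  refine le_trans (Finset.sum_le_sum fun i _ => ?_) (ENNReal.sum_le_tsum _)
  rw [ENNReal.ofReal_sum_of_nonneg fun j _ => sq_nonneg (c i j)]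
  exact ENNReal.sum_le_tsum _

theorem tsum_le_of_sqSum_le {c : ℕ → ℕ → ℝ} {B : ℝ} (hB : ∀ N, sqSum c N ≤ B) :
    ∑' (i : ℕ) (j : ℕ), ENNReal.ofReal (c i j ^ 2) ≤ ENNReal.ofReal B := by
  rw [← ENNReal.tsum_prod (f := fun i j => ENNReal.ofReal (c i j ^ 2)), ENNReal.tsum_eq_iSup_sum]
  refine iSup_le fun t => ?_
  obtain ⟨N₁, h₁⟩ := (t.image Prod.fst).exists_nat_subset_range
  obtain ⟨N₂, h₂⟩ := (t.image Prod.snd).exists_nat_subset_range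
  set N := max N₁ N₂
  have hsub : t ⊆ Finset.range N ×ˢ Finset.range N := fun z hz => by
    have hz₁ := Finset.mem_range.1 (h₁ (Finset.mem_image_of_mem _ hz))
    have hz₂ := Finset.mem_range.1 (h₂ (Finset.mem_image_of_mem _ hz))
    exact Finset.mem_product.2 ⟨Finset.mem_range.2 (lt_max_of_lt_left hz₁),
      Finset.mem_range.2 (lt_max_of_lt_right hz₂)⟩
  refine (Finset.sum_le_sum_of_subset hsub).trans ?_
  rw [← ENNReal.ofReal_sum_of_nonneg fun z _ => sq_nonneg _]
  refine ENNReal.ofReal_le_ofReal (le_trans (le_of_eq ?_) (hB N))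
  rw [Finset.sum_product, sqSum, Finset.sum_comm]

theorem exists_sqSum_le {p : ℝ} (hp : 1 < p) :
    ∃ C : ℝ, 0 < C ∧ ∀ (f : ℝ → ℝ → ℝ) (lam : ℕ → ℕ → ℝ), InLambdaClass p f lam →
      ∀ N, sqSum lam N ≤ (C * (Lp2Norm p f).toReal) ^ 2 := by
  have hpq := Real.HolderConjugate.conjExponent hp
  set q := p.conjExponent
  obtain ⟨C, hC, hbound⟩ := exists_eLpNorm_lacunaryPoly_le hpq.symm.lt.le
  refine ⟨C / π ^ 2, by positivity, fun f lam h N => ?_⟩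
  have hF : Lp2Norm p f = ENNReal.ofReal (Lp2Norm p f).toReal :=
    (ENNReal.ofReal_toReal h.1.norm_ne_top).symm
  have hpos := sqSum_nonneg lam N
  have hle : ENNReal.ofReal (π ^ 2 * sqSum lam N) ≤
      ENNReal.ofReal ((Lp2Norm p f).toReal * (C * √(sqSum lam N))) := by
    rw [← h.integral_mul_lacunaryPoly hp N]
    calc ENNReal.ofReal (∫ z, Function.uncurry f z * lacunaryPoly lam N z ∂squareMeasure)
        ≤ ‖∫ z, Function.uncurry f z * lacunaryPoly lam N z ∂squareMeasure‖ₑ := by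
          rw [Real.enorm_eq_ofReal_abs]
          exact ENNReal.ofReal_le_ofReal (le_abs_self _)
      _ ≤ ∫⁻ z, ‖Function.uncurry f z * lacunaryPoly lam N z‖ₑ ∂squareMeasure :=
          enorm_integral_le_lintegral_enorm _
      _ = ∫⁻ z, ((fun z => ‖Function.uncurry f z‖ₑ) * fun z => ‖lacunaryPoly lam N z‖ₑ) z
            ∂squareMeasure := lintegral_congr fun z => enorm_mul _ _
      _ ≤ _ := ENNReal.lintegral_mul_le_Lp_mul_Lq _ hpq h.1.meas.enorm.aemeasurable
          (continuous_lacunaryPoly lam N).measurable.enorm.aemeasurable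
      _ = eLpNorm (Function.uncurry f) (ENNReal.ofReal p) squareMeasure *
            eLpNorm (lacunaryPoly lam N) (ENNReal.ofReal q) squareMeasure := by
          rw [eLpNorm_eq_lintegral_rpow_enorm_toReal (by simpa using hpq.pos)
            ENNReal.ofReal_ne_top, eLpNorm_eq_lintegral_rpow_enorm_toReal
            (by simpa using hpq.symm.pos) ENNReal.ofReal_ne_top,
            ENNReal.toReal_ofReal hpq.nonneg, ENNReal.toReal_ofReal hpq.symm.nonneg]
      _ ≤ ENNReal.ofReal (Lp2Norm p f).toReal * ENNReal.ofReal (C * √(sqSum lam N)) := by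
          rw [← hF, Lp2Norm_eq_eLpNorm hpq.pos h.1.meas]
          exact mul_le_mul_right (hbound N lam) _
      _ = _ := (ENNReal.ofReal_mul ENNReal.toReal_nonneg).symm
  rw [ENNReal.ofReal_le_ofReal_iff (by positivity)] at hle
  rcases hpos.eq_or_lt with h0 | h0
  · rw [← h0]
    positivity
  · have hs : 0 < √(sqSum lam N) := sqrt_pos.2 h0
    rw [← sqrt_le_left (by positivity), div_mul_eq_mul_div, le_div_iff₀ (by positivity)]
    refine le_of_mul_le_mul_right ?_ hs
    calc √(sqSum lam N) * π ^ 2 * √(sqSum lam N) = π ^ 2 * sqSum lam N := by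
          rw [mul_right_comm, mul_self_sqrt hpos, mul_comm]
      _ ≤ _ := hle.trans_eq (by ring)

theorem exists_Lp2Norm_le {p : ℝ} (hp : 1 < p) :
    ∃ C : ℝ, 0 < C ∧ ∀ (f : ℝ → ℝ → ℝ) (lam : ℕ → ℕ → ℝ) (B : ℝ), InLambdaClass p f lam →
      (∀ N, sqSum lam N ≤ B) → Lp2Norm p f ≤ ENNReal.ofReal C *
        (∑' (i : ℕ) (j : ℕ), ENNReal.ofReal (lam i j ^ 2)) ^ ((1:ℝ) / 2) := by
  have hp1 : 1 ≤ ENNReal.ofReal p := ENNReal.one_le_ofReal.2 hp.le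
  obtain ⟨C, hC, hbound⟩ := exists_eLpNorm_lacunaryPoly_le hp.le
  refine ⟨C, hC, fun f lam B h hB => ?_⟩
  have hf := h.1.memLp (by linarith)
  obtain ⟨g, hg, hlim⟩ := exists_tendsto_eLpNorm_lacunaryPoly_sub hp.le hB
  have hmem : ∀ N, MemLp (lacunaryPoly lam N) (ENNReal.ofReal p) squareMeasure := fun N =>
    ⟨(continuous_lacunaryPoly lam N).aestronglyMeasurable,
      (hbound N lam).trans_lt ENNReal.ofReal_lt_top⟩
  have hcoeff : ∀ s n t m, trigCoeff (Function.uncurry f - g) s n t m = 0 := by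
    intro s n t m
    have heq := tendsto_nhds_unique ((tendsto_trigCoeff hp.le hmem hg hlim s n t m).congr'
      (h.eventually_trigCoeff_eq hp s n t m)) tendsto_const_nhds
    simp only [trigCoeff, Pi.sub_apply, sub_mul] at heq ⊢
    rw [integral_sub ((hf.integrable hp1).mul_trig s n t m) ((hg.integrable hp1).mul_trig s n t m),
      heq, sub_self]
  have hfg : Function.uncurry f =ᵐ[squareMeasure] g :=
    (ae_eq_zero_of_trigCoeff_eq_zero ((hf.sub hg).integrable hp1) hcoeff).mono
      fun z hz => sub_eq_zero.1 hz
  rw [Lp2Norm_eq_eLpNorm (by linarith) h.1.meas, eLpNorm_congr_ae hfg]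
  set S := ∑' (i : ℕ) (j : ℕ), ENNReal.ofReal (lam i j ^ 2)
  have hle : ∀ N, eLpNorm g (ENNReal.ofReal p) squareMeasure ≤
      ENNReal.ofReal C * S ^ ((1:ℝ) / 2) +
        eLpNorm (lacunaryPoly lam N - g) (ENNReal.ofReal p) squareMeasure := by
    intro N
    have hg' : g = lacunaryPoly lam N - (lacunaryPoly lam N - g) := by simp
    conv_lhs => rw [hg']
    refine (eLpNorm_sub_le (hmem N).aestronglyMeasurable
      ((hmem N).sub hg).aestronglyMeasurable hp1).trans ?_
    gcongr
    refine (hbound N lam).trans ?_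
    rw [ENNReal.ofReal_mul hC.le, Real.sqrt_eq_rpow,
      ← ENNReal.ofReal_rpow_of_nonneg (sqSum_nonneg lam N) (by norm_num)]
    gcongr
    exact ofReal_sqSum_le_tsum lam N
  have hlim' := tendsto_const_nhds (x := ENNReal.ofReal C * S ^ ((1:ℝ) / 2)).add hlim
  rw [add_zero] at hlim'
  exact ge_of_tendsto' hlim' hle

/-- Norm equivalence for double lacunary cosine series (Lemma 3.9). -/
theorem lacunary_norm_equiv (p : ℝ) (hp : 1 < p) :
    ∃ C : ℝ, 0 < C ∧ ∀ (f : ℝ → ℝ → ℝ) (lam : ℕ → ℕ → ℝ), InLambdaClass p f lam →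
      Lp2Norm p f ≤ ENNReal.ofReal C *
          (∑' (μ₁ : ℕ) (μ₂ : ℕ), ENNReal.ofReal (lam μ₁ μ₂ ^ 2)) ^ ((1:ℝ)/2) ∧
      (∑' (μ₁ : ℕ) (μ₂ : ℕ), ENNReal.ofReal (lam μ₁ μ₂ ^ 2)) ^ ((1:ℝ)/2) ≤
          ENNReal.ofReal C * Lp2Norm p f := by
  obtain ⟨C₁, hC₁, hlow⟩ := exists_sqSum_le hp
  obtain ⟨C₂, hC₂, hup⟩ := exists_Lp2Norm_le hp
  refine ⟨max C₁ C₂, lt_max_of_lt_left hC₁, fun f lam h => ⟨?_, ?_⟩⟩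
  · refine (hup f lam _ h (hlow f lam h)).trans ?_
    gcongr
    exact le_max_right _ _
  · calc (∑' (μ₁ : ℕ) (μ₂ : ℕ), ENNReal.ofReal (lam μ₁ μ₂ ^ 2)) ^ ((1:ℝ)/2)
        ≤ ENNReal.ofReal ((C₁ * (Lp2Norm p f).toReal) ^ 2) ^ ((1:ℝ)/2) := by
          gcongr
          exact tsum_le_of_sqSum_le (hlow f lam h)
      _ = ENNReal.ofReal C₁ * Lp2Norm p f := by
          rw [ENNReal.ofReal_rpow_of_nonneg (sq_nonneg _) (by norm_num), ← Real.sqrt_eq_rpow,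
            sqrt_sq (by positivity), ENNReal.ofReal_mul hC₁.le,
            ENNReal.ofReal_toReal h.1.norm_ne_top]
      _ ≤ _ := by
          gcongr
          exact le_max_left _ _

end
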